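/- Let θ, θ̃ ∈ ℓ²(ℤ;ℂ) and let g be any Borel probability measure on [0,1]. Then the total variation distance between the mixture measures P_{θ,g} and P_{θ̃,g} on ℂ^ℤ satisfies d_TV(P_{θ,g}, P_{θ̃,g}) ≤ ‖θ − θ̃‖ / √2, where ‖θ − θ̃‖ is the ℓ²(ℤ) norm of θ − θ̃. -/

import Mathlib

open MeasureTheory Real Set

/-- the standard complex Gaussian probability measure N_ℂ(μ,1) on ℂ,
with Lebesgue density z ↦ π⁻¹ e^{−|z−μ|²} -/
noncomputable def gaussC (μ : ℂ) : Measure ℂ :=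
  volume.withDensity (fun z => ENNReal.ofReal (Real.pi⁻¹ * Real.exp (-‖z - μ‖ ^ 2)))

/-- the rotated sequence (θ•φ)_k = θ_k e^{−2iπkφ} -/
noncomputable def rotZ (θ : ℤ → ℂ) (φ : ℝ) : ℤ → ℂ :=
  fun k => θ k * Complex.exp (-Complex.I * (2 * Real.pi * (k : ℝ) * φ))

/-- `P` is the product measure ⊗_{k∈ℤ} N_ℂ(θ_k e^{−2iπkφ}, 1) on ℂ^ℤ (product σ-algebra),
characterized as the projective limit of its finite-dimensional Gaussian product marginals. -/
def IsGaussProduct (θ : ℤ → ℂ) (φ : ℝ) (P : Measure (ℤ → ℂ)) : Prop :=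
  IsProbabilityMeasure P ∧
    IsProjectiveLimit P (fun J : Finset ℤ => Measure.pi (fun k : J => gaussC (rotZ θ φ k)))

/-- g is a Borel probability measure on [0,1] (encoded as a measure on ℝ carried by [0,1]) -/
def IsProbOn01 (g : MeasureTheory.Measure ℝ) : Prop :=
  MeasureTheory.IsProbabilityMeasure g ∧ g (Set.Icc 0 1) = 1

/-- `P` is the mixture P_{θ,g}(A) = ∫₀¹ (⊗_{k∈ℤ} N_ℂ(θ_k e^{−2iπkφ},1))(A) dg(φ) on ℂ^ℤ. -/
def IsMixtureLaw (θ : ℤ → ℂ) (g : Measure ℝ) (P : Measure (ℤ → ℂ)) : Prop :=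
  ∃ Pp : ℝ → Measure (ℤ → ℂ), (∀ φ : ℝ, IsGaussProduct θ φ (Pp φ)) ∧
    ∀ A : Set (ℤ → ℂ), MeasurableSet A → P A = ∫⁻ φ, Pp φ A ∂g

/-- Hellinger distance between two measures (computed through densities with respect to
the dominating measure P + Q; it does not depend on this choice). -/
noncomputable def dH {X : Type*} [MeasurableSpace X] (P Q : Measure X) : ℝ :=
  Real.sqrt (∫ x, (Real.sqrt ((P.rnDeriv (P + Q) x).toReal)
      - Real.sqrt ((Q.rnDeriv (P + Q) x).toReal)) ^ 2 ∂(P + Q))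

/-- total variation distance between two measures: sup over measurable sets A of |P(A) − Q(A)| -/
noncomputable def dTV {X : Type*} [MeasurableSpace X] (P Q : Measure X) : ℝ :=
  ⨆ (A : Set X) (_ : MeasurableSet A), |(P A).toReal - (Q A).toReal|

/-- the ℓ²(ℤ) norm of a sequence -/
noncomputable def l2norm (θ : ℤ → ℂ) : ℝ := Real.sqrt (∑' k : ℤ, ‖θ k‖ ^ 2)

theorem measure_abs_sub_le_of_measureDense {X : Type*} [MeasurableSpace X] {p q : Measure X}
    [IsFiniteMeasure p] [IsFiniteMeasure q] {𝒜 : Set (Set X)} (h𝒜 : (p + q).MeasureDense 𝒜)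
    {c : ℝ} (hc : ∀ t ∈ 𝒜, |p.real t - q.real t| ≤ c) {s : Set X} (hs : MeasurableSet s) :
    |p.real s - q.real s| ≤ c := by
  refine le_of_forall_pos_le_add fun ε hε ↦ ?_
  obtain ⟨t, ht, hst⟩ := h𝒜.approx s hs (measure_ne_top _ _) ε hε
  have htm := h𝒜.measurable t ht
  have key : ∀ (m : Measure X) [IsFiniteMeasure m], |m.real s - m.real t| ≤ m.real (symmDiff s t) :=
    fun m _ ↦ abs_measureReal_sub_le_measureReal_symmDiff hs.nullMeasurableSet htm.nullMeasurableSet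
  have hreal : p.real (symmDiff s t) + q.real (symmDiff s t) < ε := by
    rw [← measureReal_add_apply]
    exact (ENNReal.toReal_lt_of_lt_ofReal hst)
  have h1 := abs_le.1 (key p)
  have h2 := abs_le.1 (key q)
  have h3 := abs_le.1 (hc t ht)
  rw [abs_le]
  constructor <;> linarith

/-- Total variation is bounded through the Hellinger affinity `a = ∫ f g` of square-root
densities `f` and `g`. -/
theorem abs_setIntegral_sq_sub_sq_le {X : Type*} [MeasurableSpace X] {μ : Measure X}
    {f g : X → ℝ} (hf : MemLp f 2 μ) (hg : MemLp g 2 μ) {a : ℝ} (hfi : ∫ x, f x ^ 2 ∂μ = 1)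
    (hgi : ∫ x, g x ^ 2 ∂μ = 1) (hfg : ∫ x, f x * g x ∂μ = a) {s : Set X}
    (hs : MeasurableSet s) :
    |∫ x in s, f x ^ 2 ∂μ - ∫ x in s, g x ^ 2 ∂μ| ≤ √(1 - a ^ 2) := by
  have hf2 := hf.integrable_sq
  have hg2 := hg.integrable_sq
  have hfgI : Integrable (fun x ↦ f x * g x) μ := hf.integrable_mul hg
  have hfgS : Integrable (fun x ↦ f x ^ 2 + g x ^ 2) μ := hf2.add hg2
  have hI : Integrable (fun x ↦ f x ^ 2 - g x ^ 2) μ := hf2.sub hg2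
  have hcompl := integral_add_compl hs hI
  have htot : ∫ x, (f x ^ 2 - g x ^ 2) ∂μ = 0 := by
    rw [integral_sub hf2 hg2, hfi, hgi, sub_self]
  have hhalf : 2 * |∫ x in s, (f x ^ 2 - g x ^ 2) ∂μ| ≤ ∫ x, |f x ^ 2 - g x ^ 2| ∂μ := by
    have hA := abs_integral_le_integral_abs (μ := μ.restrict s) (f := fun x ↦ f x ^ 2 - g x ^ 2)
    have hB := abs_integral_le_integral_abs (μ := μ.restrict sᶜ) (f := fun x ↦ f x ^ 2 - g x ^ 2)
    have hneg : ∫ x in sᶜ, (f x ^ 2 - g x ^ 2) ∂μ = -∫ x in s, (f x ^ 2 - g x ^ 2) ∂μ := by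
      linarith
    rw [hneg, abs_neg] at hB
    have := integral_add_compl hs hI.abs
    linarith
  have hsub : ∫ x, (f x - g x) ^ 2 ∂μ = 2 - 2 * a := by
    have : ∀ x, (f x - g x) ^ 2 = (f x ^ 2 + g x ^ 2) - 2 * (f x * g x) := fun x ↦ by ring
    simp_rw [this]
    rw [integral_sub hfgS (hfgI.const_mul 2), integral_add hf2 hg2, integral_const_mul,
      hfi, hgi, hfg]
    ring
  have hadd : ∫ x, (f x + g x) ^ 2 ∂μ = 2 + 2 * a := by
    have : ∀ x, (f x + g x) ^ 2 = (f x ^ 2 + g x ^ 2) + 2 * (f x * g x) := fun x ↦ by ring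
    simp_rw [this]
    rw [integral_add hfgS (hfgI.const_mul 2), integral_add hf2 hg2, integral_const_mul,
      hfi, hgi, hfg]
    ring
  have hsub0 : 0 ≤ 2 - 2 * a := hsub ▸ integral_nonneg fun x ↦ sq_nonneg _
  have hadd0 : 0 ≤ 2 + 2 * a := hadd ▸ integral_nonneg fun x ↦ sq_nonneg _
  have hCS : ∫ x, |f x ^ 2 - g x ^ 2| ∂μ ≤ √(2 - 2 * a) * √(2 + 2 * a) := by
    have h := integral_mul_le_Lp_mul_Lq_of_nonneg (μ := μ) Real.HolderConjugate.two_two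
      (f := fun x ↦ |f x - g x|) (g := fun x ↦ |f x + g x|)
      (.of_forall fun _ ↦ abs_nonneg _) (.of_forall fun _ ↦ abs_nonneg _)
      (by rw [ENNReal.ofReal_ofNat]; exact (hf.sub hg).abs)
      (by rw [ENNReal.ofReal_ofNat]; exact (hf.add hg).abs)
    simp only [Real.rpow_two, sq_abs, hsub, hadd, ← Real.sqrt_eq_rpow] at h
    refine le_of_eq_of_le (integral_congr_ae (.of_forall fun x ↦ ?_)) h
    simp only [← abs_mul]
    congr 1
    ring
  rw [← integral_sub hf2.integrableOn hg2.integrableOn]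
  have hsq : √(2 - 2 * a) * √(2 + 2 * a) = 2 * √(1 - a ^ 2) := by
    rw [← Real.sqrt_mul hsub0, show (2 - 2 * a) * (2 + 2 * a) = 2 ^ 2 * (1 - a ^ 2) by ring,
      Real.sqrt_mul (by norm_num), Real.sqrt_sq (by norm_num)]
  linarith

theorem integral_gaussC_density_sqrt_mul (μ ν : ℂ) :
    ∫ z : ℂ, (√π)⁻¹ * rexp (-‖z - μ‖ ^ 2 / 2) * ((√π)⁻¹ * rexp (-‖z - ν‖ ^ 2 / 2)) =
      rexp (-‖μ - ν‖ ^ 2 / 4) := by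
  have hid : ∀ z : ℂ, (√π)⁻¹ * rexp (-‖z - μ‖ ^ 2 / 2) * ((√π)⁻¹ * rexp (-‖z - ν‖ ^ 2 / 2)) =
      π⁻¹ * rexp (-‖μ - ν‖ ^ 2 / 4) * rexp (-1 * ‖z - (μ + ν) / 2‖ ^ 2) := by
    intro z
    have hpi : (√π)⁻¹ * (√π)⁻¹ = π⁻¹ := by
      rw [← mul_inv, Real.mul_self_sqrt pi_pos.le]
    have hexp : rexp (-‖z - μ‖ ^ 2 / 2) * rexp (-‖z - ν‖ ^ 2 / 2) =
        rexp (-‖μ - ν‖ ^ 2 / 4) * rexp (-1 * ‖z - (μ + ν) / 2‖ ^ 2) := by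
      rw [← Real.exp_add, ← Real.exp_add]
      congr 1
      simp only [Complex.sq_norm, Complex.normSq_apply, Complex.sub_re, Complex.sub_im,
        Complex.add_re, Complex.add_im, Complex.div_ofNat_re, Complex.div_ofNat_im]
      ring
    rw [mul_mul_mul_comm, hpi, hexp, mul_assoc]
  simp_rw [hid]
  rw [integral_const_mul, integral_sub_right_eq_self (fun z : ℂ ↦ rexp (-1 * ‖z‖ ^ 2)),
    GaussianFourier.integral_rexp_neg_mul_sq_norm one_pos, Complex.finrank_real_complex]
  norm_num
  field_simp

theorem sq_gaussC_density_sqrt (μ z : ℂ) :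
    ((√π)⁻¹ * rexp (-‖z - μ‖ ^ 2 / 2)) ^ 2 = π⁻¹ * rexp (-‖z - μ‖ ^ 2) := by
  rw [mul_pow, inv_pow, Real.sq_sqrt pi_pos.le, ← Real.exp_nat_mul]
  congr 2
  push_cast
  ring

theorem integral_gaussC_density (μ : ℂ) : ∫ z : ℂ, π⁻¹ * rexp (-‖z - μ‖ ^ 2) = 1 := by
  simp_rw [← sq_gaussC_density_sqrt, pow_two ((√π)⁻¹ * _), integral_gaussC_density_sqrt_mul]
  simp

theorem integrable_gaussC_density (μ : ℂ) :
    Integrable fun z : ℂ ↦ π⁻¹ * rexp (-‖z - μ‖ ^ 2) :=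
  .of_integral_ne_zero (by simp [integral_gaussC_density])

instance (μ : ℂ) : IsProbabilityMeasure (gaussC μ) where
  measure_univ := by
    rw [gaussC, withDensity_apply _ .univ, Measure.restrict_univ,
      ← ofReal_integral_eq_lintegral_ofReal (integrable_gaussC_density μ)
        (.of_forall fun z ↦ by positivity), integral_gaussC_density, ENNReal.ofReal_one]

theorem pi_withDensity_ofReal {ι : Type*} [Fintype ι] {E : ι → Type*}
    [∀ i, MeasurableSpace (E i)] (μ : ∀ i, Measure (E i)) [∀ i, SigmaFinite (μ i)]
    {f : ∀ i, E i → ℝ} (hf : ∀ i, Integrable (f i) (μ i)) (hf0 : ∀ i x, 0 ≤ f i x) :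
    Measure.pi (fun i ↦ (μ i).withDensity fun x ↦ ENNReal.ofReal (f i x)) =
      (Measure.pi μ).withDensity fun x ↦ ENNReal.ofReal (∏ i, f i (x i)) := by
  have hfin : ∀ i, IsFiniteMeasure ((μ i).withDensity fun x ↦ ENNReal.ofReal (f i x)) :=
    fun i ↦ isFiniteMeasure_withDensity_ofReal (hf i).2
  refine Measure.pi_eq fun s hs ↦ ?_
  rw [withDensity_apply _ (.univ_pi hs), Measure.restrict_pi_pi,
    ← ofReal_integral_eq_lintegral_ofReal
      (Integrable.fintype_prod_dep fun i ↦ (hf i).integrableOn)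
      (.of_forall fun x ↦ Finset.prod_nonneg fun i _ ↦ hf0 i _),
    integral_fintype_prod_eq_prod,
    ENNReal.ofReal_prod_of_nonneg fun i _ ↦ integral_nonneg fun x ↦ hf0 i x]
  refine Finset.prod_congr rfl fun i _ ↦ ?_
  rw [withDensity_apply _ (hs i), ofReal_integral_eq_lintegral_ofReal (hf i).integrableOn
    (.of_forall fun x ↦ hf0 i x)]

theorem pi_gaussC_abs_sub_le {ι : Type*} [Fintype ι] (μ ν : ι → ℂ) {s : Set (ι → ℂ)}
    (hs : MeasurableSet s) :
    |(Measure.pi fun i ↦ gaussC (μ i)).real s - (Measure.pi fun i ↦ gaussC (ν i)).real s| ≤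
      √((∑ i, ‖μ i - ν i‖ ^ 2) / 2) := by
  set F : (ι → ℂ) → (ι → ℂ) → ℝ := fun m x ↦ ∏ i, ((√π)⁻¹ * rexp (-‖x i - m i‖ ^ 2 / 2))
  have hF2 : ∀ m x, F m x ^ 2 = ∏ i, (π⁻¹ * rexp (-‖x i - m i‖ ^ 2)) := fun m x ↦ by
    simp_rw [F, ← Finset.prod_pow, sq_gaussC_density_sqrt]
  have hint : ∀ m, Integrable fun x ↦ F m x ^ 2 := fun m ↦ by
    simp_rw [hF2]
    exact Integrable.fintype_prod_dep fun i ↦ integrable_gaussC_density (m i)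
  have hmeas : ∀ m, Continuous (F m) := fun m ↦ by fun_prop
  have hmem : ∀ m, MemLp (F m) 2 := fun m ↦
    (memLp_two_iff_integrable_sq (hmeas m).aestronglyMeasurable).2 (hint m)
  have hone : ∀ m, ∫ x, F m x ^ 2 = 1 := fun m ↦ by
    simp_rw [hF2]
    rw [integral_fintype_prod_volume_eq_prod fun i z ↦ π⁻¹ * rexp (-‖z - m i‖ ^ 2)]
    simp [integral_gaussC_density]
  have haff : ∫ x, F μ x * F ν x = rexp (-(∑ i, ‖μ i - ν i‖ ^ 2) / 4) := by
    simp_rw [F, ← Finset.prod_mul_distrib]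
    rw [integral_fintype_prod_volume_eq_prod fun i z ↦
      (√π)⁻¹ * rexp (-‖z - μ i‖ ^ 2 / 2) * ((√π)⁻¹ * rexp (-‖z - ν i‖ ^ 2 / 2))]
    simp_rw [integral_gaussC_density_sqrt_mul, ← Real.exp_sum, neg_div, Finset.sum_neg_distrib,
      Finset.sum_div]
  have hreal : ∀ m : ι → ℂ, (Measure.pi fun i ↦ gaussC (m i)).real s = ∫ x in s, F m x ^ 2 :=
    fun m ↦ by
      simp_rw [gaussC]
      rw [pi_withDensity_ofReal (fun _ ↦ volume) (fun i ↦ integrable_gaussC_density (m i))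
        (fun i z ↦ by positivity), measureReal_def, withDensity_apply _ hs]
      simp_rw [← hF2]
      rw [← volume_pi, ← ofReal_integral_eq_lintegral_ofReal (hint m).integrableOn
        (.of_forall fun x ↦ sq_nonneg _), ENNReal.toReal_ofReal (integral_nonneg fun x ↦ sq_nonneg _)]
  rw [hreal, hreal]
  refine (abs_setIntegral_sq_sub_sq_le (hmem μ) (hmem ν) (hone μ) (hone ν) haff hs).trans
    (Real.sqrt_le_sqrt ?_)
  rw [← Real.exp_nat_mul]
  have := Real.add_one_le_exp ((2 : ℕ) * (-(∑ i, ‖μ i - ν i‖ ^ 2) / 4))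
  push_cast at this ⊢
  linarith

theorem norm_rotZ_sub (θ θt : ℤ → ℂ) (φ : ℝ) (k : ℤ) :
    ‖rotZ θ φ k - rotZ θt φ k‖ = ‖θ k - θt k‖ := by
  have : -Complex.I * (2 * π * (k : ℝ) * φ) = ((-(2 * π * k * φ) : ℝ) : ℂ) * Complex.I := by
    push_cast
    ring
  rw [rotZ, rotZ, ← sub_mul, norm_mul, this, Complex.norm_exp_ofReal_mul_I, mul_one]

theorem IsGaussProduct.abs_sub_le {θ θt : ℤ → ℂ} (hsum : Summable fun k ↦ ‖θ k - θt k‖ ^ 2)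
    {φ : ℝ} {p q : Measure (ℤ → ℂ)} (hp : IsGaussProduct θ φ p) (hq : IsGaussProduct θt φ q)
    {s : Set (ℤ → ℂ)} (hs : MeasurableSet s) :
    |p.real s - q.real s| ≤ l2norm (fun k ↦ θ k - θt k) / √2 := by
  obtain ⟨hp1, hp⟩ := hp
  obtain ⟨hq1, hq⟩ := hq
  refine measure_abs_sub_le_of_measureDense (.of_generateFrom_isSetAlgebra_finite _
    isSetAlgebra_measurableCylinders generateFrom_measurableCylinders.symm) (fun t ht ↦ ?_) hs
  obtain ⟨J, S, hS, rfl⟩ := (mem_measurableCylinders t).1 ht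
  rw [measureReal_def, measureReal_def, hp.measure_cylinder J hS, hq.measure_cylinder J hS]
  refine (pi_gaussC_abs_sub_le _ _ hS).trans ?_
  rw [l2norm, ← Real.sqrt_div' _ zero_le_two]
  refine Real.sqrt_le_sqrt ?_
  simp_rw [norm_rotZ_sub]
  rw [Finset.sum_coe_sort J fun k ↦ ‖θ k - θt k‖ ^ 2]
  gcongr
  exact hsum.sum_le_tsum J fun _ _ ↦ sq_nonneg _

theorem IsMixtureLaw.le_add {θ θt : ℤ → ℂ} (hsum : Summable fun k ↦ ‖θ k - θt k‖ ^ 2)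
    {g : Measure ℝ} [IsProbabilityMeasure g] {P Q : Measure (ℤ → ℂ)} (hP : IsMixtureLaw θ g P)
    (hQ : IsMixtureLaw θt g Q) {s : Set (ℤ → ℂ)} (hs : MeasurableSet s) :
    P s ≤ Q s + ENNReal.ofReal (l2norm (fun k ↦ θ k - θt k) / √2) := by
  obtain ⟨p, hp, hPp⟩ := hP
  obtain ⟨q, hq, hQq⟩ := hQ
  set c := l2norm (fun k ↦ θ k - θt k) / √2
  calc P s = ∫⁻ φ, p φ s ∂g := hPp s hs
    _ ≤ ∫⁻ φ, (q φ s + ENNReal.ofReal c) ∂g := by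
      refine lintegral_mono fun φ ↦ ?_
      have := (hp φ).1
      have := (hq φ).1
      have h := (abs_le.1 ((hp φ).abs_sub_le hsum (hq φ) hs)).2
      have hc : 0 ≤ c := div_nonneg (Real.sqrt_nonneg _) (Real.sqrt_nonneg _)
      change p φ s ≤ q φ s + ENNReal.ofReal c
      rw [← ofReal_measureReal (μ := p φ), ← ofReal_measureReal (μ := q φ),
        ← ENNReal.ofReal_add measureReal_nonneg hc]
      exact ENNReal.ofReal_le_ofReal (by linarith)
    _ = Q s + ENNReal.ofReal c := by
      rw [lintegral_add_right _ measurable_const, ← hQq s hs]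
      simp

theorem IsMixtureLaw.isProbabilityMeasure {θ : ℤ → ℂ} {g : Measure ℝ} [IsProbabilityMeasure g]
    {P : Measure (ℤ → ℂ)} (hP : IsMixtureLaw θ g P) : IsProbabilityMeasure P := by
  obtain ⟨p, hp, hPp⟩ := hP
  refine ⟨?_⟩
  have h1 : ∀ φ, p φ univ = 1 := fun φ ↦ (hp φ).1.measure_univ
  simp [hPp univ .univ, h1]

theorem summable_norm_sub_sq {ι E : Type*} [SeminormedAddCommGroup E] {f g : ι → E}
    (hf : Summable fun i ↦ ‖f i‖ ^ 2) (hg : Summable fun i ↦ ‖g i‖ ^ 2) :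
    Summable fun i ↦ ‖f i - g i‖ ^ 2 := by
  refine .of_nonneg_of_le (fun _ ↦ sq_nonneg _) (fun i ↦ ?_) ((hf.add hg).mul_left 2)
  have h := pow_le_pow_left₀ (norm_nonneg _) (norm_sub_le (f i) (g i)) 2
  nlinarith [sq_nonneg (‖f i‖ - ‖g i‖)]

/-- d_TV(P_{θ,g}, P_{θ̃,g}) ≤ ‖θ − θ̃‖/√2. -/
theorem tv_mixture_le_l2 (θ θt : ℤ → ℂ)
    (hθ : Summable (fun k : ℤ => ‖θ k‖ ^ 2)) (hθt : Summable (fun k : ℤ => ‖θt k‖ ^ 2))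
    (g : Measure ℝ) (hg : IsProbOn01 g)
    (P Q : Measure (ℤ → ℂ)) (hP : IsMixtureLaw θ g P) (hQ : IsMixtureLaw θt g Q) :
    dTV P Q ≤ l2norm (fun k => θ k - θt k) / Real.sqrt 2 := by
  have := hg.1
  have := hP.isProbabilityMeasure
  have := hQ.isProbabilityMeasure
  have hsum := summable_norm_sub_sq hθ hθt
  have hc : 0 ≤ l2norm (fun k => θ k - θt k) / √2 :=
    div_nonneg (Real.sqrt_nonneg _) (Real.sqrt_nonneg _)
  refine Real.iSup_le (fun A ↦ Real.iSup_le (fun hA ↦ ?_) hc) hc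
  have h1 := hP.le_add hsum hQ hA
  have h2 := hQ.le_add (summable_norm_sub_sq hθt hθ) hP hA
  have hcomm : l2norm (fun k ↦ θt k - θ k) = l2norm (fun k ↦ θ k - θt k) := by
    simp_rw [l2norm, norm_sub_rev]
  rw [hcomm] at h2
  have toReal_le : ∀ {a b : ENNReal}, b ≠ ⊤ →
      a ≤ b + ENNReal.ofReal (l2norm (fun k ↦ θ k - θt k) / √2) →
      a.toReal ≤ b.toReal + l2norm (fun k ↦ θ k - θt k) / √2 := fun {a b} hb h ↦ by
    have := ENNReal.toReal_mono (by finiteness) h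
    rwa [ENNReal.toReal_add hb (by finiteness), ENNReal.toReal_ofReal hc] at this
  have h1 := toReal_le (measure_ne_top _ _) h1
  have h2 := toReal_le (measure_ne_top _ _) h2
  rw [abs_le]
  constructor <;> linarith
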